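/- Let g be a finite-dimensional unimodular real Lie algebra of dimension 2n that contains an abelian ideal a of codimension 2, and let J be a complex structure on g with J(a) = a. If (g,J) admits a balanced Hermitian metric and also admits a pluriclosed Hermitian metric (possibly different), then (g,J) admits a Kähler Hermitian metric. -/

import Mathlib

open Module

section Defs

variable {L : Type*} [LieRing L] [LieAlgebra ℝ L]

/-- A complex structure on a real Lie algebra: `J² = -id` plus integrability. -/
def IsComplexStructure (J : L →ₗ[ℝ] L) : Prop :=
  (∀ x : L, J (J x) = -x) ∧
  (∀ x y : L, ⁅x, y⁆ - ⁅J x, J y⁆ + J ⁅J x, y⁆ + J ⁅x, J y⁆ = 0)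

/-- A Lie algebra is unimodular if every `ad x` is traceless. -/
def IsUnimodularLie (L : Type*) [LieRing L] [LieAlgebra ℝ L] : Prop :=
  ∀ x : L, LinearMap.trace ℝ L (LieAlgebra.ad ℝ L x) = 0

/-- A Hermitian metric on `(L, J)`: a `J`-compatible inner product. -/
structure HermMetric (J : L →ₗ[ℝ] L) : Type _ where
  B : L →ₗ[ℝ] L →ₗ[ℝ] ℝ
  symm : ∀ x y : L, B x y = B y x
  posdef : ∀ x : L, x ≠ 0 → 0 < B x x
  compat : ∀ x y : L, B (J x) (J y) = B x y

variable {J : L →ₗ[ℝ] L}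

/-- The Kähler form `ω(x,y) = ⟨Jx, y⟩`. -/
def HermMetric.omega (g : HermMetric J) (x y : L) : ℝ := g.B (J x) y

/-- Exterior differential of the Kähler form. -/
def HermMetric.dOmega (g : HermMetric J) (x y z : L) : ℝ :=
  - g.omega ⁅x, y⁆ z + g.omega ⁅x, z⁆ y - g.omega ⁅y, z⁆ x

/-- `dᶜω (x,y,z) = -dω(Jx, Jy, Jz)`. -/
def HermMetric.dcOmega (g : HermMetric J) (x y z : L) : ℝ :=
  - g.dOmega (J x) (J y) (J z)

/-- `d(dᶜω)` as a 4-form. -/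
def HermMetric.ddcOmega (g : HermMetric J) (x y z w : L) : ℝ :=
  - g.dcOmega ⁅x, y⁆ z w + g.dcOmega ⁅x, z⁆ y w - g.dcOmega ⁅x, w⁆ y z
  - g.dcOmega ⁅y, z⁆ x w + g.dcOmega ⁅y, w⁆ x z - g.dcOmega ⁅z, w⁆ x y

/-- The metric is Kähler if `dω = 0`. -/
def HermMetric.IsKahler (g : HermMetric J) : Prop :=
  ∀ x y z : L, g.dOmega x y z = 0

/-- The metric is pluriclosed if `d(dᶜω) = 0`. -/
def HermMetric.IsPluriclosed (g : HermMetric J) : Prop :=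
  ∀ x y z w : L, g.ddcOmega x y z w = 0

/-- The metric is balanced (dimension `2n`): for every orthonormal basis `f`,
`Σ_k dω(f_k, J f_k, x) = 0` for all `x`. -/
def HermMetric.IsBalanced (g : HermMetric J) (n : ℕ) : Prop :=
  ∀ f : Basis (Fin (2 * n)) ℝ L,
    (∀ i j, g.B (f i) (f j) = if i = j then 1 else 0) →
    ∀ x : L, (∑ k, g.dOmega (f k) (J (f k)) x) = 0

end Defs

section OrthonormalBases

variable {V : Type*} [AddCommGroup V] [Module ℝ V]

/-- Every positive definite symmetric form on a finite-dimensional space has an orthonormal basis. -/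
theorem exists_orthonormal_basis_of_posDef [FiniteDimensional ℝ V] {n : ℕ}
    (hn : finrank ℝ V = n) (B : V →ₗ[ℝ] V →ₗ[ℝ] ℝ) (symm : ∀ x y, B x y = B y x)
    (posdef : ∀ x, x ≠ 0 → 0 < B x x) :
    ∃ f : Basis (Fin n) ℝ V, ∀ i j, B (f i) (f j) = if i = j then 1 else 0 := by
  let core : InnerProductSpace.Core ℝ V :=
    { inner := fun x y => B x y
      conj_inner_symm := fun x y => by simp [symm x y]
      re_inner_nonneg := fun x => by
        rcases eq_or_ne x 0 with rfl | hx
        · simp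
        · simpa using (posdef x hx).le
      add_left := fun x y z => by simp
      smul_left := fun x y r => by simp
      definite := fun x hx => by
        by_contra h
        exact (posdef x h).ne' hx }
  let _ : NormedAddCommGroup V := core.toNormedAddCommGroup
  let _ : InnerProductSpace ℝ V := InnerProductSpace.ofCore core.toCore
  let b := (stdOrthonormalBasis ℝ V).reindex (finCongr hn)
  refine ⟨b.toBasis, fun i j => ?_⟩
  have h := orthonormal_iff_ite.mp b.orthonormal i j
  rw [OrthonormalBasis.coe_toBasis]
  exact h

variable {ι : Type*} [Fintype ι] [DecidableEq ι] {B : V →ₗ[ℝ] V →ₗ[ℝ] ℝ} {f : Basis ι ℝ V}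

theorem repr_eq_of_orthonormal (hf : ∀ i j, B (f i) (f j) = if i = j then 1 else 0)
    (x : V) (i : ι) : f.repr x i = B (f i) x := by
  conv_rhs => rw [← f.sum_repr x]
  simp [-Basis.sum_repr, hf]

theorem sum_smul_eq_of_orthonormal (hf : ∀ i j, B (f i) (f j) = if i = j then 1 else 0)
    (x : V) : ∑ i, B (f i) x • f i = x := by
  simp_rw [← repr_eq_of_orthonormal hf]
  exact f.sum_repr x

theorem sum_mul_eq_of_orthonormal (hf : ∀ i j, B (f i) (f j) = if i = j then 1 else 0)
    (x y : V) : ∑ i, B (f i) x * B (f i) y = B x y := by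
  conv_rhs => rw [← sum_smul_eq_of_orthonormal hf x]
  simp

theorem trace_eq_sum_of_orthonormal (hf : ∀ i j, B (f i) (f j) = if i = j then 1 else 0)
    (T : V →ₗ[ℝ] V) : LinearMap.trace ℝ V T = ∑ i, B (f i) (T (f i)) := by
  rw [LinearMap.trace_eq_matrix_trace ℝ f]
  simp [Matrix.trace, LinearMap.toMatrix_apply, repr_eq_of_orthonormal hf]

/-- `‖M‖² - tr (M²)` is half the squared norm of the skew part of `M`. -/
theorem two_mul_sum_sub_of_orthonormal (symm : ∀ x y, B x y = B y x)
    (hf : ∀ i j, B (f i) (f j) = if i = j then 1 else 0) (M : V →ₗ[ℝ] V) :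
    2 * ∑ i, (B (M (f i)) (M (f i)) - B (M (M (f i))) (f i)) =
      ∑ i, ∑ j, (B (M (f i)) (f j) - B (M (f j)) (f i)) ^ 2 := by
  have h₁ (i : ι) : B (M (f i)) (M (f i)) = ∑ j, B (M (f i)) (f j) ^ 2 := by
    rw [← sum_mul_eq_of_orthonormal hf]
    exact Finset.sum_congr rfl fun j _ => by rw [symm (f j), sq]
  have h₂ (i : ι) : B (M (M (f i))) (f i) = ∑ j, B (M (f i)) (f j) * B (M (f j)) (f i) := by
    conv_lhs => rw [← sum_smul_eq_of_orthonormal hf (M (f i))]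
    simp only [map_sum, map_smul, LinearMap.sum_apply, LinearMap.smul_apply, smul_eq_mul]
    exact Finset.sum_congr rfl fun j _ => by rw [symm (f j) (M (f i))]
  have h₃ : ∑ i, ∑ j, B (M (f j)) (f i) ^ 2 = ∑ i, ∑ j, B (M (f i)) (f j) ^ 2 :=
    Finset.sum_comm
  simp only [sub_sq, Finset.sum_add_distrib, Finset.sum_sub_distrib, h₃, h₁, h₂, mul_assoc,
    ← Finset.mul_sum]
  ring

theorem sum_sub_nonneg_of_orthonormal (symm : ∀ x y, B x y = B y x)
    (hf : ∀ i j, B (f i) (f j) = if i = j then 1 else 0) (M : V →ₗ[ℝ] V) :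
    0 ≤ ∑ i, (B (M (f i)) (M (f i)) - B (M (M (f i))) (f i)) := by
  have h := two_mul_sum_sub_of_orthonormal symm hf M
  have : 0 ≤ ∑ i, ∑ j, (B (M (f i)) (f j) - B (M (f j)) (f i)) ^ 2 := by positivity
  linarith

theorem self_adjoint_of_sum_sub_eq_zero (symm : ∀ x y, B x y = B y x)
    (hf : ∀ i j, B (f i) (f j) = if i = j then 1 else 0) (M : V →ₗ[ℝ] V)
    (hM : ∑ i, (B (M (f i)) (M (f i)) - B (M (M (f i))) (f i)) = 0) (x y : V) :
    B (M x) y = B (M y) x := by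
  have h := two_mul_sum_sub_of_orthonormal symm hf M
  rw [hM, mul_zero, eq_comm, Finset.sum_eq_zero_iff_of_nonneg (fun _ _ => by positivity)] at h
  have key : B ∘ₗ M = (B ∘ₗ M).flip := by
    refine f.ext fun i => f.ext fun j => ?_
    have hij := (Finset.sum_eq_zero_iff_of_nonneg (fun _ _ => by positivity)).mp
      (h i (Finset.mem_univ i)) j (Finset.mem_univ j)
    exact sub_eq_zero.mp (pow_eq_zero_iff two_ne_zero |>.mp hij)
  exact LinearMap.congr_fun₂ key x y

/-- The pointwise identity satisfied by `J ∘ ad X` and `J ∘ ad JX` for a pluriclosed metric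
forces both maps to be self-adjoint. -/
theorem self_adjoint_of_pointwise_identity [FiniteDimensional ℝ V]
    (symm : ∀ x y, B x y = B y x) (posdef : ∀ x, x ≠ 0 → 0 < B x x) (J M N : V →ₗ[ℝ] V)
    (hJ : ∀ x, J (J x) = -x) (compat : ∀ x y, B (J x) (J y) = B x y)
    (h : ∀ u, (B (M u) (M u) - B (M (M u)) u) +
      (B (M (J u)) (M (J u)) - B (M (M (J u))) (J u)) + (B (N u) (N u) - B (N (N u)) u) +
      (B (N (J u)) (N (J u)) - B (N (N (J u))) (J u)) = 0) :
    (∀ x y, B (M x) y = B (M y) x) ∧ ∀ x y, B (N x) y = B (N y) x := by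
  obtain ⟨e, he⟩ := exists_orthonormal_basis_of_posDef rfl B symm posdef
  let Je : V ≃ₗ[ℝ] V := LinearEquiv.ofLinearMap J (-J)
    (by ext x; simp [hJ]) (by ext x; simp [hJ])
  have he' : ∀ i j, B (e.map Je i) (e.map Je j) = if i = j then 1 else 0 := fun i j => by
    rw [Basis.map_apply, Basis.map_apply, ← he i j]
    exact compat _ _
  have hsum := Finset.sum_congr rfl fun i (_ : i ∈ Finset.univ) => h (e i)
  simp only [Finset.sum_add_distrib, Finset.sum_const_zero] at hsum
  have hM := sum_sub_nonneg_of_orthonormal symm he M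
  have hN := sum_sub_nonneg_of_orthonormal symm he N
  have hM' : 0 ≤ ∑ i, (B (M (J (e i))) (M (J (e i))) - B (M (M (J (e i)))) (J (e i))) := by
    simpa [Je] using sum_sub_nonneg_of_orthonormal symm he' M
  have hN' : 0 ≤ ∑ i, (B (N (J (e i))) (N (J (e i))) - B (N (N (J (e i)))) (J (e i))) := by
    simpa [Je] using sum_sub_nonneg_of_orthonormal symm he' N
  exact ⟨self_adjoint_of_sum_sub_eq_zero symm he M (by linarith),
    self_adjoint_of_sum_sub_eq_zero symm he N (by linarith)⟩

/-- Every vector has an orthogonal projection onto a given subspace. -/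
theorem exists_sub_orthogonal [FiniteDimensional ℝ V] (symm : ∀ x y, B x y = B y x)
    (posdef : ∀ x, x ≠ 0 → 0 < B x x) (S : Submodule ℝ V) (x : V) :
    ∃ u ∈ S, ∀ v ∈ S, B (x - u) v = 0 := by
  obtain ⟨e, he⟩ := exists_orthonormal_basis_of_posDef rfl (B.domRestrict₁₂ S S)
    (fun x y => symm x y) (fun x hx => posdef x (by simpa using hx))
  refine ⟨∑ i, B x (e i) • (e i : V), S.sum_mem fun i _ => S.smul_mem _ (e i).2, fun v hv => ?_⟩
  have key : B x ∘ₗ S.subtype = B (∑ i, B x (e i) • (e i : V)) ∘ₗ S.subtype := by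
    refine e.ext fun j => ?_
    have he' : ∀ i, B (e i) (e j) = if i = j then 1 else 0 := fun i => he i j
    simp [he']
  have := LinearMap.congr_fun key ⟨v, hv⟩
  simp only [LinearMap.comp_apply, Submodule.subtype_apply] at this
  rw [map_sub, LinearMap.sub_apply, this, sub_self]

end OrthonormalBases

section Complements

variable {V : Type*} [AddCommGroup V] [Module ℝ V] [FiniteDimensional ℝ V]

/-- A vector outside a `J`-invariant subspace of codimension two spans, together with its image
under `J`, a complement of that subspace. -/
theorem exists_sub_mem_of_finrank_add_two {S : Submodule ℝ V}
    (hcodim : finrank ℝ S + 2 = finrank ℝ V) {J : V →ₗ[ℝ] V} (hJ : ∀ x, J (J x) = -x)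
    (hJS : ∀ u ∈ S, J u ∈ S) {X : V} (hX : X ∉ S) (x : V) :
    ∃ s t : ℝ, x - s • X - t • J X ∈ S := by
  have hq : finrank ℝ (V ⧸ S) = 2 := by
    have := S.finrank_quotient_add_finrank
    omega
  have hli : LinearIndependent ℝ ![S.mkQ X, S.mkQ (J X)] := by
    rw [LinearIndependent.pair_iff]
    intro s t hst
    have h₁ : s • X + t • J X ∈ S := by
      rw [← Submodule.Quotient.mk_eq_zero]
      simpa using hst
    have h₂ : (s ^ 2 + t ^ 2) • X ∈ S := by
      have h₃ := S.sub_mem (S.smul_mem s h₁) (S.smul_mem t (hJS _ h₁))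
      convert h₃ using 1
      simp only [map_add, map_smul, hJ]
      module
    have h₄ : s ^ 2 + t ^ 2 = 0 := by
      by_contra h
      exact hX ((S.smul_mem_iff h).mp h₂)
    constructor <;> nlinarith [sq_nonneg s, sq_nonneg t]
  have hx : S.mkQ x ∈ Submodule.span ℝ (Set.range ![S.mkQ X, S.mkQ (J X)]) := by
    rw [hli.span_eq_top_of_card_eq_finrank' (by simp [hq])]
    trivial
  rw [Matrix.range_cons, Matrix.range_cons, Matrix.range_empty, Set.union_empty,
    Set.singleton_union, Submodule.mem_span_pair] at hx
  obtain ⟨s, t, hst⟩ := hx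
  refine ⟨s, t, ?_⟩
  rw [← Submodule.Quotient.mk_eq_zero, ← Submodule.mkQ_apply]
  simp only [map_sub, map_smul, ← hst]
  abel

end Complements

section HermitianMetrics

variable {L : Type*} [LieRing L] [LieAlgebra ℝ L] {J : L →ₗ[ℝ] L}

theorem HermMetric.dcOmega_eq (g : HermMetric J) (x y z : L) :
    g.dcOmega x y z = g.B ⁅J x, J y⁆ z + g.B ⁅J y, J z⁆ x + g.B ⁅J z, J x⁆ y := by
  simp only [HermMetric.dcOmega, HermMetric.dOmega, HermMetric.omega, g.compat]
  rw [← lie_skew (J z) (J x)]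
  simp only [map_neg, LinearMap.neg_apply]
  ring

theorem HermMetric.apply_map_left (g : HermMetric J) (hJ : ∀ x, J (J x) = -x) (x y : L) :
    g.B (J x) y = -g.B x (J y) := by
  rw [← g.compat (J x) y, hJ]
  simp

/-- For a balanced metric on a unimodular Lie algebra, `∑ ⁅fₖ, J fₖ⁆ = 0` for orthonormal `f`. -/
theorem HermMetric.IsBalanced.sum_lie_eq_zero {g : HermMetric J} {n : ℕ}
    (hg : g.IsBalanced n) (hJ : ∀ x, J (J x) = -x) (huni : IsUnimodularLie L)
    (f : Basis (Fin (2 * n)) ℝ L) (hf : ∀ i j, g.B (f i) (f j) = if i = j then 1 else 0) :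
    ∑ k, ⁅f k, J (f k)⁆ = 0 := by
  let Je : L ≃ₗ[ℝ] L := LinearEquiv.ofLinearMap J (-J)
    (by ext x; simp [hJ]) (by ext x; simp [hJ])
  have hf' : ∀ i j, g.B (f.map Je i) (f.map Je j) = if i = j then 1 else 0 := fun i j => by
    rw [Basis.map_apply, Basis.map_apply, ← hf i j]
    exact g.compat _ _
  by_contra hne
  set v := ∑ k, ⁅f k, J (f k)⁆ with hv
  have h := hg f hf (J v)
  have h₁ : ∑ k, g.B (f k) ⁅J v, f k⁆ = 0 := by
    rw [← huni (J v), trace_eq_sum_of_orthonormal hf]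
    rfl
  have h₂ : ∑ k, g.B (J (f k)) ⁅J v, J (f k)⁆ = 0 := by
    rw [← huni (J v), trace_eq_sum_of_orthonormal hf']
    rfl
  have h₃ (k : Fin (2 * n)) : g.dOmega (f k) (J (f k)) (J v) =
      -g.B ⁅f k, J (f k)⁆ v - g.B (f k) ⁅J v, f k⁆ - g.B (J (f k)) ⁅J v, J (f k)⁆ := by
    simp only [HermMetric.dOmega, HermMetric.omega, g.compat]
    rw [g.apply_map_left hJ ⁅J (f k), J v⁆, ← lie_skew (J v) (f k), ← lie_skew (J v) (J (f k)),
      g.symm ⁅f k, J v⁆, g.symm ⁅J (f k), J v⁆]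
    simp only [map_neg]
    ring
  simp only [h₃, Finset.sum_sub_distrib, h₁, h₂, Finset.sum_neg_distrib] at h
  have h₄ : ∑ k, g.B ⁅f k, J (f k)⁆ v = g.B v v := by
    rw [← LinearMap.sum_apply, ← map_sum]
  have := g.posdef v hne
  linarith

variable {S : Submodule ℝ L}

/-- With respect to a balanced metric, the orthogonal complement of a `J`-invariant abelian
ideal of codimension two is an abelian subalgebra. -/
theorem HermMetric.IsBalanced.lie_map_eq_zero [FiniteDimensional ℝ L]
    {g : HermMetric J} {n : ℕ}
    (hg : g.IsBalanced n) (hJ : ∀ x, J (J x) = -x) (huni : IsUnimodularLie L)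
    (hdim : finrank ℝ L = 2 * n) (habel : ∀ u ∈ S, ∀ v ∈ S, ⁅u, v⁆ = 0)
    (hJS : ∀ u ∈ S, J u ∈ S) {X : L} (hX : X ≠ 0)
    (hdec : ∀ x, x - (g.B X x / g.B X X) • X - (g.B (J X) x / g.B X X) • J X ∈ S) :
    ⁅X, J X⁆ = 0 := by
  obtain ⟨f, hf⟩ := exists_orthonormal_basis_of_posDef hdim g.B g.symm g.posdef
  have hc := g.posdef X hX
  set c := g.B X X with hcdef
  have hJXX : g.B X (J X) = 0 := by
    have h₁ := g.apply_map_left hJ X X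
    have h₂ := g.symm X (J X)
    linarith
  have hJXJX : g.B (J X) (J X) = c := g.compat X X
  let p : L → L := fun x => x - (g.B X x / c) • X - (g.B (J X) x / c) • J X
  have hexp (x : L) : ⁅x, J x⁆ =
      (g.B x X / c) • ⁅p x, J X⁆ - (g.B x (J X) / c) • ⁅p x, X⁆ +
      (g.B x X / c) • ⁅X, J (p x)⁆ + (g.B x (J X) / c) • ⁅J X, J (p x)⁆ +
      ((g.B x X / c) * (g.B x X / c) + (g.B x (J X) / c) * (g.B x (J X) / c)) • ⁅X, J X⁆ := by
    have hx : x = p x + (g.B x X / c) • X + (g.B x (J X) / c) • J X := by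
      simp only [p, g.symm x]
      module
    have h₀ : ⁅p x, J (p x)⁆ = 0 := habel _ (hdec x) _ (hJS _ (hdec x))
    generalize g.B x X / c = s at *
    generalize g.B x (J X) / c = t at *
    conv_lhs => rw [hx]
    simp only [map_add, map_smul, hJ, add_lie, lie_add, smul_lie, lie_smul, lie_neg, h₀, lie_self,
      ← lie_skew (J X) X]
    module
  have hsum := hg.sum_lie_eq_zero hJ huni f hf
  rw [Finset.sum_congr rfl fun k _ => hexp (f k)] at hsum
  simp only [Finset.sum_add_distrib, Finset.sum_sub_distrib] at hsum
  have hcoef (T : L →ₗ[ℝ] L) (y : L) :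
      ∑ k, (g.B (f k) y / c) • T (p (f k)) = c⁻¹ • T (p y) := by
    let P : L →ₗ[ℝ] L :=
        LinearMap.id - (c⁻¹ • g.B X).smulRight X - (c⁻¹ • g.B (J X)).smulRight (J X)
    have hP (x : L) : p x = P x := by
      simp [P, p, div_eq_inv_mul]
    simp only [hP]
    conv_rhs => rw [← sum_smul_eq_of_orthonormal hf y]
    simp only [map_sum, map_smul, Finset.smul_sum, smul_smul, div_eq_inv_mul]
  have hpX : p X = 0 := by
    simp [p, g.symm (J X) X, hJXX, ← hcdef, hc.ne']
  have hpJX : p (J X) = 0 := by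
    simp [p, hJXX, hJXJX, hc.ne']
  have e₁ : ∑ k, (g.B (f k) X / c) • ⁅p (f k), J X⁆ = 0 := by
    have := hcoef (-(LieAlgebra.ad ℝ L (J X))) X
    simpa [hpX] using this
  have e₂ : ∑ k, (g.B (f k) (J X) / c) • ⁅p (f k), X⁆ = 0 := by
    have := hcoef (-(LieAlgebra.ad ℝ L X)) (J X)
    simpa [hpJX] using this
  have e₃ : ∑ k, (g.B (f k) X / c) • ⁅X, J (p (f k))⁆ = 0 := by
    have := hcoef (LieAlgebra.ad ℝ L X ∘ₗ J) X
    simpa [hpX] using this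
  have e₄ : ∑ k, (g.B (f k) (J X) / c) • ⁅J X, J (p (f k))⁆ = 0 := by
    have := hcoef (LieAlgebra.ad ℝ L (J X) ∘ₗ J) (J X)
    simpa [hpJX] using this
  have e₅ : ∑ k, ((g.B (f k) X / c) * (g.B (f k) X / c) +
      (g.B (f k) (J X) / c) * (g.B (f k) (J X) / c)) = 2 / c := by
    simp only [div_mul_div_comm, Finset.sum_add_distrib, ← Finset.sum_div,
      sum_mul_eq_of_orthonormal hf, hJXJX, ← hcdef]
    field_simp
    norm_num
  rw [e₁, e₂, e₃, e₄, ← Finset.sum_smul, e₅] at hsum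
  have : (2 / c) • ⁅X, J X⁆ = 0 := by simpa using hsum
  exact (smul_eq_zero.mp this).resolve_left (by positivity)

/-- For a pluriclosed metric, `J ∘ ad X` and `J ∘ ad JX` are self-adjoint on a `J`-invariant
abelian ideal that contains `⁅X, JX⁆`. -/
theorem HermMetric.IsPluriclosed.self_adjoint_of_lie_mem [FiniteDimensional ℝ L]
    {g : HermMetric J}
    (hg : g.IsPluriclosed) (hJ : ∀ x, J (J x) = -x) (hideal : ∀ x : L, ∀ u ∈ S, ⁅x, u⁆ ∈ S)
    (habel : ∀ u ∈ S, ∀ v ∈ S, ⁅u, v⁆ = 0) (hJS : ∀ u ∈ S, J u ∈ S) {X : L}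
    (hXJX : ⁅X, J X⁆ ∈ S) :
    (∀ u ∈ S, ∀ v ∈ S, g.B (J ⁅X, u⁆) v = g.B (J ⁅X, v⁆) u) ∧
      ∀ u ∈ S, ∀ v ∈ S, g.B (J ⁅J X, u⁆) v = g.B (J ⁅J X, v⁆) u := by
  let JS : S →ₗ[ℝ] S := J.restrict hJS
  let M : L → (S →ₗ[ℝ] S) := fun x =>
    (J ∘ₗ (LieAlgebra.ad ℝ L x : L →ₗ[ℝ] L)).restrict fun u hu => hJS _ (hideal x u hu)
  have key := self_adjoint_of_pointwise_identity (B := g.B.domRestrict₁₂ S S)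
    (fun x y => g.symm x y) (fun x hx => g.posdef x (by simpa using hx)) JS (M X) (M (J X))
    (fun x => Subtype.ext (hJ x)) (fun x y => g.compat x y) (by
      rintro ⟨u, hu⟩
      change (g.B (J ⁅X, u⁆) (J ⁅X, u⁆) - g.B (J ⁅X, J ⁅X, u⁆⁆) u) +
        (g.B (J ⁅X, J u⁆) (J ⁅X, J u⁆) - g.B (J ⁅X, J ⁅X, J u⁆⁆) (J u)) +
        (g.B (J ⁅J X, u⁆) (J ⁅J X, u⁆) - g.B (J ⁅J X, J ⁅J X, u⁆⁆) u) +
        (g.B (J ⁅J X, J u⁆) (J ⁅J X, J u⁆) - g.B (J ⁅J X, J ⁅J X, J u⁆⁆) (J u)) = 0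
      have hJu := hJS u hu
      have hXS (p : L) (hp : p ∈ S) (v : L) (hv : v ∈ S) :
          g.dcOmega p X v = g.B ⁅J X, J v⁆ p - g.B ⁅J X, J p⁆ v := by
        rw [g.dcOmega_eq, habel _ (hJS v hv) _ (hJS p hp), ← lie_skew (J p) (J X)]
        simp only [map_neg, map_zero, LinearMap.neg_apply, LinearMap.zero_apply]
        ring
      have hYS (p : L) (hp : p ∈ S) (v : L) (hv : v ∈ S) :
          g.dcOmega p (J X) v = g.B ⁅X, J p⁆ v - g.B ⁅X, J v⁆ p := by
        rw [g.dcOmega_eq, habel _ (hJS v hv) _ (hJS p hp), hJ, ← lie_skew (J p) (-X)]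
        simp only [neg_lie, map_neg, map_zero, LinearMap.neg_apply, LinearMap.zero_apply]
        ring
      have hSS : g.dcOmega ⁅X, J X⁆ u (J u) = 0 := by
        rw [g.dcOmega_eq, habel _ (hJS _ hXJX) _ hJu, habel _ hJu _ (hJS _ hJu),
          habel _ (hJS _ hJu) _ (hJS _ hXJX)]
        simp
      have h₀ : g.dcOmega ⁅u, J u⁆ X (J X) = 0 := by
        rw [habel u hu _ hJu, g.dcOmega_eq]
        simp
      have h := hg X (J X) u (J u)
      rw [HermMetric.ddcOmega, hSS, h₀, hYS _ (hideal X u hu) _ hJu,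
        hYS _ (hideal X _ hJu) _ hu, hXS _ (hideal (J X) u hu) _ hJu,
        hXS _ (hideal (J X) _ hJu) _ hu, hJ] at h
      simp only [g.compat]
      rw [g.apply_map_left hJ _ u, g.apply_map_left hJ _ u]
      simp only [lie_neg, map_neg, LinearMap.neg_apply] at h
      linarith)
  exact ⟨fun u hu v hv => key.1 ⟨u, hu⟩ ⟨v, hv⟩, fun u hu v hv => key.2 ⟨u, hu⟩ ⟨v, hv⟩⟩

/-- A Hermitian metric for which `J ∘ ad X` and `J ∘ ad JX` are self-adjoint on the abelian ideal
`S` can be changed to a Kähler metric by declaring `X, JX` orthonormal and orthogonal to `S`. -/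
theorem exists_isKahler_of_self_adjoint (g : HermMetric J) (hJ : ∀ x, J (J x) = -x)
    (hideal : ∀ x : L, ∀ u ∈ S, ⁅x, u⁆ ∈ S) (habel : ∀ u ∈ S, ∀ v ∈ S, ⁅u, v⁆ = 0)
    {X : L} (hXJX : ⁅X, J X⁆ = 0) (s t : L →ₗ[ℝ] ℝ)
    (hs : ∀ u ∈ S, s u = 0) (ht : ∀ u ∈ S, t u = 0)
    (hsJ : ∀ x, s (J x) = -t x) (htJ : ∀ x, t (J x) = s x)
    (hdec : ∀ x, x - s x • X - t x • J X ∈ S)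
    (hX : ∀ u ∈ S, ∀ v ∈ S, g.B (J ⁅X, u⁆) v = g.B (J ⁅X, v⁆) u)
    (hJX : ∀ u ∈ S, ∀ v ∈ S, g.B (J ⁅J X, u⁆) v = g.B (J ⁅J X, v⁆) u) :
    ∃ k : HermMetric J, k.IsKahler := by
  let p : L →ₗ[ℝ] L := LinearMap.id - s.smulRight X - t.smulRight (J X)
  have hp (x : L) : x = p x + s x • X + t x • J X := by
    simp only [p, LinearMap.sub_apply, LinearMap.id_apply, LinearMap.smulRight_apply]
    abel
  have hpS (x : L) : p x ∈ S := hdec x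
  have hpJ (x : L) : p (J x) = J (p x) := by
    simp only [p, LinearMap.sub_apply, LinearMap.id_apply, LinearMap.smulRight_apply, hsJ, htJ,
      map_sub, map_smul, hJ]
    module
  let k : HermMetric J :=
    { B := g.B.compl₁₂ p p + s.smulRight s + t.smulRight t
      symm := fun x y => by
        simp [g.symm (p x), mul_comm]
      posdef := fun x hx => by
        simp only [LinearMap.add_apply, LinearMap.compl₁₂_apply, LinearMap.smulRight_apply,
          LinearMap.smul_apply, smul_eq_mul]
        by_cases hpx : p x = 0
        · have hst : s x ≠ 0 ∨ t x ≠ 0 := by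
            by_contra! h
            exact hx (by rw [hp x, hpx, h.1, h.2]; simp)
          rw [hpx]
          rcases hst with h | h
          · have := mul_self_pos.mpr h
            have := mul_self_nonneg (t x)
            simp only [map_zero]
            linarith
          · have := mul_self_pos.mpr h
            have := mul_self_nonneg (s x)
            simp only [map_zero]
            linarith
        · have := g.posdef _ hpx
          have := mul_self_nonneg (s x)
          have := mul_self_nonneg (t x)
          linarith
      compat := fun x y => by
        simp only [LinearMap.add_apply, LinearMap.compl₁₂_apply, LinearMap.smulRight_apply,
          LinearMap.smul_apply, smul_eq_mul, hpJ, g.compat, hsJ, htJ]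
        ring }
  have hlie (x y : L) : ⁅x, y⁆ =
      s x • ⁅X, p y⁆ + t x • ⁅J X, p y⁆ - s y • ⁅X, p x⁆ - t y • ⁅J X, p x⁆ := by
    have h₀ := habel _ (hpS x) _ (hpS y)
    conv_lhs => rw [hp x, hp y]
    simp only [add_lie, lie_add, smul_lie, lie_smul, lie_self, h₀, hXJX, ← lie_skew (p x),
      ← lie_skew (J X) X]
    module
  have hk (w : L) (hw : w ∈ S) (z : L) : k.B (J w) z = g.B (J w) (p z) := by
    have hpw : p w = w := by simp [p, hs w hw, ht w hw]
    simp [k, hpJ, hpw, hsJ, htJ, hs w hw, ht w hw]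
  have hlieS (x y : L) : ⁅x, y⁆ ∈ S := by
    rw [hlie]
    exact S.sub_mem (S.sub_mem (S.add_mem (S.smul_mem _ (hideal _ _ (hpS y)))
      (S.smul_mem _ (hideal _ _ (hpS y)))) (S.smul_mem _ (hideal _ _ (hpS x))))
      (S.smul_mem _ (hideal _ _ (hpS x)))
  refine ⟨k, fun x y z => ?_⟩
  simp only [HermMetric.dOmega, HermMetric.omega, hk _ (hlieS _ _)]
  rw [hlie x y, hlie x z, hlie y z]
  simp only [map_add, map_sub, map_smul, LinearMap.add_apply, LinearMap.sub_apply,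
    LinearMap.smul_apply, smul_eq_mul]
  rw [hX _ (hpS x) _ (hpS y), hX _ (hpS x) _ (hpS z), hX _ (hpS y) _ (hpS z),
    hJX _ (hpS x) _ (hpS y), hJX _ (hpS x) _ (hpS z), hJX _ (hpS y) _ (hpS z)]
  ring

end HermitianMetrics

theorem fino_vezzoni_stmt1
    {L : Type*} [LieRing L] [LieAlgebra ℝ L] [FiniteDimensional ℝ L]
    (a : LieIdeal ℝ L)
    (habel : ∀ u ∈ a.toSubmodule, ∀ v ∈ a.toSubmodule, ⁅u, v⁆ = (0 : L))
    (hcodim : finrank ℝ ↥a.toSubmodule + 2 = finrank ℝ L)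
    (J : L →ₗ[ℝ] L) (hJ : IsComplexStructure J)
    (huni : IsUnimodularLie L)
    (n : ℕ) (hdim : finrank ℝ L = 2 * n)
    (hJa : a.toSubmodule.map J = a.toSubmodule)
    (hbal : ∃ g : HermMetric J, g.IsBalanced n)
    (hplu : ∃ g : HermMetric J, g.IsPluriclosed) :
    ∃ g : HermMetric J, g.IsKahler := by
  obtain ⟨b, hb⟩ := hbal
  obtain ⟨g, hg⟩ := hplu
  obtain ⟨hJ, -⟩ := hJ
  set S : Submodule ℝ L := a.toSubmodule
  have hideal : ∀ x, ∀ u ∈ S, ⁅x, u⁆ ∈ S := fun x u hu => a.lie_mem hu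
  have hJS : ∀ u ∈ S, J u ∈ S := fun u hu => hJa ▸ Submodule.mem_map_of_mem hu
  obtain ⟨x₀, hx₀⟩ : ∃ x, x ∉ S := by
    by_contra! h
    rw [(Submodule.eq_top_iff'.mpr h : S = ⊤), finrank_top] at hcodim
    omega
  obtain ⟨u₀, hu₀, horth⟩ := exists_sub_orthogonal b.symm b.posdef S x₀
  set X := x₀ - u₀
  have hXS : X ∉ S := fun h => hx₀ ((S.sub_mem_iff_left hu₀).mp h)
  have hX0 : X ≠ 0 := fun h => hXS (h ▸ S.zero_mem)
  have hc := b.posdef X hX0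
  have horth' (v : L) (hv : v ∈ S) : b.B (J X) v = 0 := by
    rw [b.apply_map_left hJ, horth _ (hJS v hv), neg_zero]
  have hXJ : b.B X (J X) = 0 := by
    linarith [b.apply_map_left hJ X X, b.symm X (J X)]
  have hdec (x : L) : x - (b.B X x / b.B X X) • X - (b.B (J X) x / b.B X X) • J X ∈ S := by
    obtain ⟨s, t, h⟩ := exists_sub_mem_of_finrank_add_two hcodim hJ hJS hXS x
    have h₁ := horth _ h
    have h₂ := horth' _ h
    simp only [map_sub, map_smul, smul_eq_mul, hXJ, b.symm (J X) X, b.compat] at h₁ h₂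
    have hs : b.B X x / b.B X X = s := by
      rw [div_eq_iff hc.ne']
      linarith
    have ht : b.B (J X) x / b.B X X = t := by
      rw [div_eq_iff hc.ne']
      linarith
    rwa [hs, ht]
  have hXJX : ⁅X, J X⁆ = 0 := hb.lie_map_eq_zero hJ huni hdim habel hJS hX0 hdec
  obtain ⟨hA, hB⟩ :=
    hg.self_adjoint_of_lie_mem hJ hideal habel hJS (X := X) (hXJX ▸ S.zero_mem)
  refine exists_isKahler_of_self_adjoint g hJ hideal habel hXJX
    ((b.B X X)⁻¹ • b.B X) ((b.B X X)⁻¹ • b.B (J X)) (fun v hv => ?_) (fun v hv => ?_)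
    (fun x => ?_) (fun x => ?_) (fun x => ?_) hA hB
  · simp [horth v hv]
  · simp [horth' v hv]
  · simp [b.apply_map_left hJ]
  · simp [b.compat]
  · simpa [div_eq_inv_mul] using hdec x
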